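/- There exists a constant C ∈ ℕ such that for every nondeterministic parity automaton A over a finite alphabet Σ with n ≥ 2 states whose priorities are all at most m, there exists a deterministic Rabin automaton over Σ recognizing the same ω-language whose state set has cardinality at most n^(C·(m+1)·n) and whose Rabin acceptance condition consists of at most C·(m+1)·2^n Rabin pairs. -/

import Mathlib

open Filter

/-- A nondeterministic parity automaton over alphabet `A`. -/
structure NPA (A : Type) where
  Q : Type
  [fin : Fintype Q]
  Δ : Q → A → Set Q
  qI : Q
  Ω : Q → ℕ

attribute [instance] NPA.fin

/-- A run of a nondeterministic parity automaton on an infinite word. -/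
def NPA.IsRun {A : Type} (P : NPA A) (w : ℕ → A) (ρ : ℕ → P.Q) : Prop :=
  ρ 0 = P.qI ∧ ∀ i, ρ (i + 1) ∈ P.Δ (ρ i) (w i)

/-- A run is accepting if the least priority occurring infinitely often is even. -/
def NPA.AcceptingRun {A : Type} (P : NPA A) (w : ℕ → A) (ρ : ℕ → P.Q) : Prop :=
  P.IsRun w ρ ∧
    ∃ k : ℕ, IsLeast {k | ∃ᶠ i in atTop, P.Ω (ρ i) = k} k ∧ Even k

/-- Acceptance for a nondeterministic parity automaton. -/
def NPA.Accepts {A : Type} (P : NPA A) (w : ℕ → A) : Prop :=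
  ∃ ρ : ℕ → P.Q, P.AcceptingRun w ρ

/-- A deterministic Rabin automaton over alphabet `A`. -/
structure DRA (A : Type) where
  Q : Type
  [fin : Fintype Q]
  δ : Q → A → Q
  qI : Q
  R : Finset (Set Q × Set Q)

attribute [instance] DRA.fin

/-- The unique run of a deterministic Rabin automaton on an infinite word. -/
def DRA.run {A : Type} (D : DRA A) (w : ℕ → A) : ℕ → D.Q
  | 0 => D.qI
  | i + 1 => D.δ (D.run w i) (w i)

/-- Rabin acceptance: for some pair `(E, G)` in the condition, the run visits `G`
infinitely often and `E` only finitely often. -/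
def DRA.Accepts {A : Type} (D : DRA A) (w : ℕ → A) : Prop :=
  ∃ p ∈ D.R, (∃ᶠ i in atTop, D.run w i ∈ p.2) ∧ (∀ᶠ i in atTop, D.run w i ∉ p.1)


theorem exists_path_of_finite_paths {Q : Type*} [Finite Q] (R : ℕ → Q → Q → Prop)
    (h : ∀ n, ∃ a : ℕ → Q, ∀ k < n, R k (a k) (a (k + 1))) :
    ∃ ρ : ℕ → Q, ∀ k, R k (ρ k) (ρ (k + 1)) := by
  choose a ha using h
  have hlim : ∀ k, ∃ q, ∀ᶠ n in (hyperfilter ℕ : Filter ℕ), a n k = q := by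
    intro k
    rw [← Ultrafilter.eventually_exists_iff]
    exact Eventually.of_forall fun n => ⟨_, rfl⟩
  choose ρ hρ using hlim
  refine ⟨ρ, fun k => ?_⟩
  have hk : ∀ᶠ n in (hyperfilter ℕ : Filter ℕ), k < n :=
    (Nat.hyperfilter_le_atTop) (eventually_gt_atTop k)
  obtain ⟨n, h1, h2, h3⟩ := ((hρ k).and ((hρ (k + 1)).and hk)).exists
  rw [← h1, ← h2]
  exact ha n k h3

theorem antitone_from_stabilizes {α : Type*} [LinearOrder α] [Finite α] (f : ℕ → α) (T : ℕ)
    (hf : ∀ t ≥ T, f (t + 1) ≤ f t) : ∃ T' ≥ T, ∀ t ≥ T', f t = f T' := by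
  obtain ⟨x, ⟨T', hT', rfl⟩, hmin⟩ := (Set.toFinite (f '' Set.Ici T)).exists_minimal
    ⟨_, T, le_refl T, rfl⟩
  refine ⟨T', hT', fun t ht => ?_⟩
  have hle : f t ≤ f T' := by
    induction t, ht using Nat.le_induction with
    | base => exact le_rfl
    | succ t ht ih => exact (hf t (le_trans hT' ht)).trans ih
  exact le_antisymm hle (hmin ⟨t, le_trans hT' ht, rfl⟩ hle)

/-- A levelled forest of finite width whose levels `P t` are linearly ordered.  The node `c` of
level `t + 1` has parent `π t c`, the order of a level refines the order of the parents, and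
among siblings a marked node comes before an unmarked one. -/
structure SliceForest (α : Type*) [LinearOrder α] where
  P : ℕ → Set α
  π : ℕ → α → α
  F : ℕ → Set α
  parent_mem : ∀ {t c}, c ∈ P (t + 1) → π t c ∈ P t
  parent_mono : ∀ {t c d}, c ∈ P (t + 1) → d ∈ P (t + 1) → c ≤ d → π t c ≤ π t d
  siblings : ∀ {t c d}, c ∈ P (t + 1) → d ∈ P (t + 1) → c < d → π t c = π t d →
    c ∈ F (t + 1) ∧ d ∉ F (t + 1)

namespace SliceForest

variable {α : Type*} [LinearOrder α] (S : SliceForest α)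

/-- `B` is an infinite branch from level `T` on. -/
def IsBranch (T : ℕ) (B : ℕ → α) : Prop :=
  ∀ t ≥ T, B t ∈ S.P t ∧ S.π t (B (t + 1)) = B t

/-- `c` is the last node of level `t + 1` whose parent does not lie beyond `p`. -/
def Next (t : ℕ) (p c : α) : Prop :=
  IsGreatest {c | c ∈ S.P (t + 1) ∧ S.π t c ≤ p} c

/-- The ancestor on level `d` of a node of level `d + k`. -/
def anc (d : ℕ) : ℕ → α → α
  | 0, x => x
  | k + 1, x => anc d k (S.π (d + k) x)

theorem anc_mem {d k : ℕ} {x : α} (hx : x ∈ S.P (d + k)) : S.anc d k x ∈ S.P d := by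
  induction k generalizing x with
  | zero => exact hx
  | succ k ih => exact ih (S.parent_mem hx)

theorem anc_mono {d k : ℕ} {x y : α} (hx : x ∈ S.P (d + k)) (hy : y ∈ S.P (d + k))
    (h : x ≤ y) : S.anc d k x ≤ S.anc d k y := by
  induction k generalizing x y with
  | zero => exact h
  | succ k ih => exact ih (S.parent_mem hx) (S.parent_mem hy) (S.parent_mono hx hy h)

theorem anc_succ (d k : ℕ) (x : α) : S.anc d (k + 1) x = S.π d (S.anc (d + 1) k x) := by
  induction k generalizing x with
  | zero => rfl
  | succ k ih =>
    have h : d + 1 + k = d + (k + 1) := by omega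
    rw [anc, ih, anc, h]

theorem Next.unique {S : SliceForest α} {t : ℕ} {p c d : α} (h : S.Next t p c)
    (h' : S.Next t p d) : c = d :=
  IsGreatest.unique h h'

theorem exists_next [Finite α] {t : ℕ} {p b : α} (hb : b ∈ S.P (t + 1)) (h : S.π t b ≤ p) :
    ∃ c, S.Next t p c ∧ b ≤ c := by
  obtain ⟨c, hc, hmax⟩ := (Set.toFinite {c | c ∈ S.P (t + 1) ∧ S.π t c ≤ p}).exists_maximal
    ⟨b, hb, h⟩
  have hgreat : S.Next t p c := ⟨hc, fun d hd => (le_total d c).elim id (hmax hd)⟩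
  exact ⟨c, hgreat, hgreat.2 ⟨hb, h⟩⟩

/-- A sequence of nodes that only drifts to the left, and infinitely often drifts strictly or
meets a marked node, yields a branch that is marked infinitely often. -/
theorem exists_branch_of_drift [Finite α] {T : ℕ} {x : ℕ → α} (hmem : ∀ t ≥ T, x t ∈ S.P t)
    (hdrift : ∀ t ≥ T, S.π t (x (t + 1)) ≤ x t)
    (hinf : ∃ᶠ t in atTop, ¬ (S.π t (x (t + 1)) = x t ∧ x (t + 1) ∉ S.F (t + 1))) :
    ∃ B, S.IsBranch T B ∧ ∃ᶠ t in atTop, B (t + 1) ∈ S.F (t + 1) := by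
  have hanti : ∀ d ≥ T, ∀ k ≥ 0,
      S.anc d (k + 1) (x (d + (k + 1))) ≤ S.anc d k (x (d + k)) := by
    intro d hd k _
    exact S.anc_mono (S.parent_mem (hmem (d + k + 1) (by omega))) (hmem _ (by omega))
      (hdrift (d + k) (by omega))
  have hstab : ∀ d, ∃ b K, d ≥ T → ∀ k ≥ K, S.anc d k (x (d + k)) = b := by
    intro d
    by_cases hd : d ≥ T
    · obtain ⟨K, -, hK⟩ :=
        antitone_from_stabilizes (fun k => S.anc d k (x (d + k))) 0 (hanti d hd)
      exact ⟨_, K, fun _ => hK⟩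
    · exact ⟨x 0, 0, fun h => absurd h hd⟩
  choose B K hK using hstab
  have hB : S.IsBranch T B := by
    intro d hd
    refine ⟨?_, ?_⟩
    · rw [← hK d hd (K d) le_rfl]
      exact S.anc_mem (hmem _ (by omega))
    · rw [← hK d hd (max (K d) (K (d + 1)) + 1) (by omega),
        ← hK (d + 1) (by omega) (max (K d) (K (d + 1))) (by omega), S.anc_succ]
      congr 3
      omega
  have hBle : ∀ t ≥ T, B t ≤ x t := by
    intro t ht
    rw [← hK t ht (K t) le_rfl]
    have h : ∀ k, S.anc t k (x (t + k)) ≤ x t := by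
      intro k
      induction k with
      | zero => exact le_rfl
      | succ k ih => exact (hanti t ht k (Nat.zero_le _)).trans ih
    exact h _
  refine ⟨B, hB, fun hfin => ?_⟩
  obtain ⟨d₀, hd₀⟩ := eventually_atTop.1 hfin
  set d := max d₀ T with hd
  have hright : ∀ k y, y ∈ S.P (d + k) → S.anc d k y ≤ B d → y ≤ B (d + k) := by
    intro k
    induction k with
    | zero => intro y _ h; exact h
    | succ k ih =>
      intro y hy h
      by_contra hlt
      have h1 : S.π (d + k) y ≤ B (d + k) := ih _ (S.parent_mem hy) h
      have h2 := (hB (d + k) (by omega)).2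
      have h3 := (hB (d + k + 1) (by omega)).1
      have h4 : S.π (d + k) (B (d + k + 1)) ≤ S.π (d + k) y :=
        S.parent_mono h3 hy (le_of_not_ge hlt)
      have h5 := S.siblings h3 hy (not_le.1 hlt) (le_antisymm h4 (h1.trans h2.ge))
      exact hd₀ (d + k) (by omega) h5.1
  have heq : ∀ t ≥ d + K d, x t = B t := by
    intro t ht
    obtain ⟨k, rfl⟩ : ∃ k, t = d + k := ⟨t - d, by omega⟩
    refine le_antisymm (hright k _ (hmem _ (by omega)) ?_) (hBle _ (by omega))
    exact (hK d (by omega) k (by omega)).le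
  refine hinf (eventually_atTop.2 ⟨d + K d, fun t ht => ?_⟩)
  rw [not_not, heq t ht, heq (t + 1) (by omega)]
  exact ⟨(hB t (by omega)).2, hd₀ t (by omega)⟩

/-- Rankings of the slots of all levels that are passed on along `Next`, a node reached by several
slots receiving the smallest of their ranks. -/
structure Ranking (rk : ℕ → α → α) : Prop where
  inj : ∀ t, Function.Injective (rk t)
  le_of_next : ∀ {t p c}, S.Next t p c → rk (t + 1) c ≤ rk t p
  min_of_next : ∀ {t p c d}, S.Next t p c → (∀ q, S.Next t q d → rk t p ≤ rk t q) →
    rk (t + 1) c ≤ rk (t + 1) d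

variable {S}

/-- Within sets `U t` of slots compatible with `Next`, the slot of smallest rank that does not
lie left of a given branch is passed on along `Next` and its rank stabilizes. -/
theorem Ranking.exists_stable [Finite α] {rk : ℕ → α → α} (hrk : S.Ranking rk) {T : ℕ}
    {B : ℕ → α} (hB : S.IsBranch T B) {U : ℕ → Set α} (hBU : ∀ t ≥ T, B t ∈ U t)
    (hback : ∀ t ≥ T, ∀ p c, S.Next t p c → c ∈ U (t + 1) → p ∈ U t)
    (hforw : ∀ t ≥ T, ∀ p c, S.Next t p c → p ∈ U t → c ∈ U (t + 1)) :
    ∃ T' ≥ T, ∃ (r : α) (p : ℕ → α), ∀ t ≥ T', S.Next t (p t) (p (t + 1)) ∧ rk t (p t) = r ∧ B t ≤ p t ∧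
      p t ∈ U t ∧ ∀ x ∈ U t, B t ≤ x → rk t (p t) ≤ rk t x := by
  have hmin : ∀ t, ∃ p, t ≥ T → B t ≤ p ∧ p ∈ U t ∧ ∀ x ∈ U t, B t ≤ x → rk t p ≤ rk t x := by
    intro t
    by_cases ht : t ≥ T
    · obtain ⟨p, hp, hle⟩ := Set.exists_min_image {x | x ∈ U t ∧ B t ≤ x} (rk t)
        (Set.toFinite _) ⟨B t, hBU t ht, le_rfl⟩
      exact ⟨p, fun _ => ⟨hp.2, hp.1, fun x hx hx' => hle x ⟨hx, hx'⟩⟩⟩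
    · exact ⟨B t, fun h => absurd h ht⟩
  choose p hp using hmin
  have hnext : ∀ t ≥ T, S.Next t (p t) (p (t + 1)) := by
    intro t ht
    obtain ⟨h1, h2, h3⟩ := hp t ht
    obtain ⟨h4, h5, h6⟩ := hp (t + 1) (by omega)
    obtain ⟨hmem, hpar⟩ := hB t ht
    obtain ⟨hmem', -⟩ := hB (t + 1) (by omega)
    obtain ⟨c, hc, hBc⟩ := S.exists_next hmem' (hpar.le.trans h1)
    have hcp : rk (t + 1) c ≤ rk (t + 1) (p (t + 1)) := by
      refine hrk.min_of_next hc fun q hq => h3 q (hback t ht _ _ hq h5) ?_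
      rw [← hpar]
      exact (S.parent_mono hmem' hq.1.1 h4).trans hq.1.2
    have hpc := h6 c (hforw t ht _ _ hc h2) hBc
    rwa [← hrk.inj _ (le_antisymm hcp hpc)]
  obtain ⟨T', hT', hstab⟩ := antitone_from_stabilizes (fun t => rk t (p t)) T
    fun t ht => hrk.le_of_next (hnext t ht)
  refine ⟨T', hT', rk T' (p T'), p, fun t ht => ?_⟩
  obtain ⟨h1, h2, h3⟩ := hp t (le_trans hT' ht)
  exact ⟨hnext t (le_trans hT' ht), hstab t ht, h1, h2, h3⟩

/-- A branch that is marked infinitely often is witnessed by a stable rank which infinitely often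
is not passed on to an unmarked child. -/
theorem Ranking.exists_rank_of_branch [Finite α] {rk : ℕ → α → α} (hrk : S.Ranking rk) {T : ℕ}
    {B : ℕ → α} (hB : S.IsBranch T B) (hF : ∃ᶠ t in atTop, B (t + 1) ∈ S.F (t + 1)) :
    ∃ (r : α) (T : ℕ) (p : ℕ → α), (∀ t ≥ T, S.Next t (p t) (p (t + 1)) ∧ rk t (p t) = r) ∧
      ∃ᶠ t in atTop, ¬ (S.π t (p (t + 1)) = p t ∧ p (t + 1) ∉ S.F (t + 1)) := by
  let stable : Set α := {r | ∃ T' ≥ T, ∃ p : ℕ → α, ∀ t ≥ T', S.Next t (p t) (p (t + 1)) ∧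
    rk t (p t) = r ∧ B t ≤ p t ∧ ∀ x ≤ p t, B t ≤ x → rk t (p t) ≤ rk t x}
  have hne : stable.Nonempty := by
    obtain ⟨T', hT', r, p, hp⟩ := hrk.exists_stable hB (U := fun _ => Set.univ)
      (fun _ _ => trivial) (fun _ _ _ _ _ _ => trivial) (fun _ _ _ _ _ _ => trivial)
    refine ⟨r, T', hT', p, fun t ht => ?_⟩
    obtain ⟨h1, h2, h3, -, h5⟩ := hp t ht
    exact ⟨h1, h2, h3, fun x _ => h5 x trivial⟩
  obtain ⟨r, ⟨T₁, hT₁, p, hp⟩, hmax⟩ := (Set.toFinite stable).exists_maximal hne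
  refine ⟨r, T₁, p, fun t ht => ⟨(hp t ht).1, (hp t ht).2.1⟩, fun hfin => ?_⟩
  obtain ⟨T₂, hT₂⟩ := eventually_atTop.1 hfin
  obtain ⟨s, hs, hsF⟩ := frequently_atTop.1 hF (max T₁ T₂)
  have hlt : ∀ t ≥ s + 1, B t < p t := by
    intro t ht
    induction t, ht using Nat.le_induction with
    | base =>
      refine lt_of_le_of_ne (hp _ (by omega)).2.2.1 fun h => ?_
      exact (not_not.1 (hT₂ s (by omega))).2 (h ▸ hsF)
    | succ t ht ih =>
      refine lt_of_le_of_ne (hp _ (by omega)).2.2.1 fun h => ih.ne ?_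
      rw [← (hB t (by omega)).2, h]
      exact (not_not.1 (hT₂ t (by omega))).1
  obtain ⟨T₃, hT₃, r', q, hq⟩ := hrk.exists_stable (T := s + 1)
    (fun t ht => hB t (by omega)) (U := fun t => Set.Iio (p t)) hlt
    (fun t ht x c hx hc => by
      by_contra hle
      have h1 := (not_not.1 (hT₂ t (by omega))).1
      exact absurd hc (not_lt.2 (hx.2 ⟨(hp t (by omega)).1.1.1, h1.le.trans (not_lt.1 hle)⟩)))
    (fun t ht x c hx hxp => by
      by_contra hle
      have h1 := (not_not.1 (hT₂ t (by omega))).1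
      have h2 := S.parent_mono (hp t (by omega)).1.1.1 hx.1.1 (not_lt.1 hle)
      exact absurd hxp (not_lt.2 (h1.ge.trans (h2.trans hx.1.2))))
  have hr' : r' ∈ stable := by
    refine ⟨T₃, by omega, q, fun t ht => ?_⟩
    obtain ⟨h1, h2, h3, h4, h5⟩ := hq t ht
    exact ⟨h1, h2, h3, fun x hx => h5 x (lt_of_le_of_lt hx h4)⟩
  obtain ⟨-, h2, h3, h4, -⟩ := hq T₃ le_rfl
  obtain ⟨-, h6, -, h8⟩ := hp T₃ (by omega)
  have hle : r ≤ r' := by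
    rw [← h6, ← h2]
    exact h8 _ (le_of_lt h4) h3
  have heq : rk T₃ (p T₃) = rk T₃ (q T₃) := by
    rw [h6, h2]
    exact le_antisymm hle (hmax hr' hle)
  exact absurd (hrk.inj _ heq) (ne_of_gt h4)

end SliceForest

/-- The position of `x` when a finite type is arranged by increasing value. -/
noncomputable def compress {X : Type*} [Fintype X] (v : X → ℕ) (x : X) : Fin (Fintype.card X) :=
  ⟨(Finset.univ.filter fun y => v y < v x).card,
    Finset.card_lt_univ_of_notMem (x := x) (by simp)⟩

theorem compress_le_iff {X : Type*} [Fintype X] (v : X → ℕ) (x y : X) :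
    compress v x ≤ compress v y ↔ v x ≤ v y := by
  constructor
  · intro h
    by_contra hlt
    refine absurd h (not_le.2 (Fin.mk_lt_mk.2 (Finset.card_lt_card ?_)))
    rw [Finset.ssubset_iff_of_subset]
    · exact ⟨y, by simpa using hlt, by simp⟩
    · intro z hz
      simp only [Finset.mem_filter, Finset.mem_univ, true_and] at hz ⊢
      omega
  · intro h
    refine Fin.mk_le_mk.2 (Finset.card_le_card fun z hz => ?_)
    simp only [Finset.mem_filter, Finset.mem_univ, true_and] at hz ⊢
    omega

theorem compress_le_value {X : Type*} [Fintype X] {v : X → ℕ} (hv : Function.Injective v)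
    (x : X) : (compress v x : ℕ) ≤ v x := by
  calc (Finset.univ.filter fun y => v y < v x).card
      ≤ (Finset.range (v x)).card :=
        Finset.card_le_card_of_injOn v (fun y hy => by simpa using hy) hv.injOn
    _ = v x := Finset.card_range _

theorem compress_injective {X : Type*} [Fintype X] {v : X → ℕ} (hv : Function.Injective v) :
    Function.Injective (compress v) := fun x y h =>
  hv (le_antisymm ((compress_le_iff v x y).1 h.le) ((compress_le_iff v y x).1 h.ge))

/-- A nondeterministic Büchi automaton over alphabet `A`. -/
structure NBA (A : Type) where
  Q : Type
  [fin : Fintype Q]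
  δ : Q → A → Set Q
  qI : Q
  F : Set Q

attribute [instance] NBA.fin

namespace NBA

variable {A : Type} (M : NBA A)

/-- Acceptance: some run visits `F` infinitely often. -/
def Accepts (w : ℕ → A) : Prop :=
  ∃ ρ : ℕ → M.Q, ρ 0 = M.qI ∧ (∀ i, ρ (i + 1) ∈ M.δ (ρ i) (w i)) ∧ ∃ᶠ i in atTop, ρ i ∈ M.F

/-- The slots of the determinization; a state is assigned at most one slot. -/
abbrev Slot : Type := Fin (Fintype.card M.Q)

/-- An assignment of slots to the currently reachable states. -/
abbrev Slice : Type := M.Q → Option M.Slot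

variable {M}

/-- `p` is the leftmost slot with a state from which `q` is reached by reading `a`. -/
def Parent (pos : M.Slice) (a : A) (q : M.Q) (p : M.Slot) : Prop :=
  IsLeast {c | ∃ q₀, pos q₀ = some c ∧ q ∈ M.δ q₀ a} p

open Classical in
/-- Encodes the lexicographic order by parent slot, with accepting states first. -/
noncomputable def value (pos : M.Slice) (a : A) (q : M.Q) : ℕ :=
  sInf {v | ∃ q₀, ∃ c : M.Slot, pos q₀ = some c ∧ q ∈ M.δ q₀ a ∧
    v = 2 * (c : ℕ) + if q ∈ M.F then 0 else 1}

open Classical in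
/-- The slice after reading `a`. -/
noncomputable def stepPos (pos : M.Slice) (a : A) : M.Slice := fun q =>
  if ∃ q₀ c, pos q₀ = some c ∧ q ∈ M.δ q₀ a then some (compress (value pos a) q) else none

/-- `c` is the rightmost new slot whose parent does not lie beyond `p`. -/
def NextSlot (pos : M.Slice) (a : A) (p c : M.Slot) : Prop :=
  IsGreatest {c | ∃ q p₀, stepPos pos a q = some c ∧ Parent pos a q p₀ ∧ p₀ ≤ p} c

/-- `c` is the new slot of the nonaccepting states with parent `p`. -/
def Continues (pos : M.Slice) (a : A) (p c : M.Slot) : Prop :=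
  ∃ q, stepPos pos a q = some c ∧ Parent pos a q p ∧ q ∉ M.F

/-- The least rank passed on to the slot `c`, or a fresh large number if there is none. -/
noncomputable def key (pos : M.Slice) (rk : M.Slot → M.Slot) (a : A) (c : M.Slot) : ℕ :=
  sInf (insert (Fintype.card M.Q + c : ℕ) {v | ∃ p, NextSlot pos a p c ∧ v = rk p})

/-- The ranking of slots after reading `a`. -/
noncomputable def stepRk (pos : M.Slice) (rk : M.Slot → M.Slot) (a : A) (c : M.Slot) : M.Slot :=
  Fin.cast (Fintype.card_fin _) (compress (key pos rk a) c)

variable (M) in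
/-- A slice, a ranking of the slots, the set of ranks that were passed on unchanged by the last
transition and the set of ranks that were not passed on to an unmarked child. -/
abbrev State : Type :=
  M.Slice × (M.Slot → M.Slot) × Set M.Slot × Set M.Slot

/-- The transition function of the determinization. -/
noncomputable def step (s : M.State) (a : A) : M.State :=
  (stepPos s.1 a, stepRk s.1 s.2.1 a,
    {r | ∃ p c, s.2.1 p = r ∧ NextSlot s.1 a p c ∧ stepRk s.1 s.2.1 a c = r},
    {r | ∃ p c, s.2.1 p = r ∧ NextSlot s.1 a p c ∧ ¬ Continues s.1 a p c})

open Classical in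
variable (M) in
/-- The initial state of the determinization. -/
noncomputable def initial : M.State :=
  (fun q => if q = M.qI then some ⟨0, Fintype.card_pos_iff.2 ⟨M.qI⟩⟩ else none, id, ∅, ∅)

open Classical in
variable (M) in
/-- Determinization of a Büchi automaton. -/
noncomputable def toDRA : DRA A where
  Q := M.State
  fin := inferInstance
  δ := step
  qI := M.initial
  R := Finset.univ.image fun r : M.Slot => ({s | r ∉ s.2.2.1}, {s | r ∈ s.2.2.2})

section Step

variable {pos : M.Slice} {a : A}

theorem value_eq {q : M.Q} [Decidable (q ∈ M.F)] {p : M.Slot} (h : Parent pos a q p) :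
    value pos a q = 2 * (p : ℕ) + if q ∈ M.F then 0 else 1 := by
  refine IsLeast.csInf_eq ⟨?_, ?_⟩
  · obtain ⟨q₀, h1, h2⟩ := h.1
    exact ⟨q₀, p, h1, h2, by congr⟩
  · rintro v ⟨q₀, c, h1, h2, rfl⟩
    have h3 : (p : ℕ) ≤ c := h.2 ⟨q₀, h1, h2⟩
    split_ifs <;> omega

theorem exists_parent {q q₀ : M.Q} {c : M.Slot} (h₀ : pos q₀ = some c) (hq : q ∈ M.δ q₀ a) :
    ∃ p, Parent pos a q p ∧ p ≤ c := by
  obtain ⟨p, hp, hmin⟩ := Set.exists_min_image {c | ∃ q₀, pos q₀ = some c ∧ q ∈ M.δ q₀ a} id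
    (Set.toFinite _) ⟨c, q₀, h₀, hq⟩
  exact ⟨p, ⟨hp, hmin⟩, hmin c ⟨q₀, h₀, hq⟩⟩

theorem exists_pred_of_stepPos {q : M.Q} {c : M.Slot} (h : stepPos pos a q = some c) :
    ∃ q₀ c₀, pos q₀ = some c₀ ∧ q ∈ M.δ q₀ a := by
  by_contra hn
  rw [stepPos, if_neg hn] at h
  exact absurd h (by simp)

theorem exists_parent_of_stepPos {q : M.Q} {c : M.Slot} (h : stepPos pos a q = some c) :
    ∃ p, Parent pos a q p := by
  obtain ⟨q₀, c₀, h1, h2⟩ := exists_pred_of_stepPos h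
  obtain ⟨p, hp, -⟩ := exists_parent h1 h2
  exact ⟨p, hp⟩

theorem exists_stepPos {q q₀ : M.Q} {c : M.Slot} (h₀ : pos q₀ = some c) (hq : q ∈ M.δ q₀ a) :
    ∃ d, stepPos pos a q = some d := by
  rw [stepPos, if_pos ⟨q₀, c, h₀, hq⟩]
  exact ⟨_, rfl⟩

theorem value_le_iff {q q' : M.Q} {c c' : M.Slot} (h : stepPos pos a q = some c)
    (h' : stepPos pos a q' = some c') : value pos a q ≤ value pos a q' ↔ c ≤ c' := by
  rw [stepPos, if_pos (exists_pred_of_stepPos h), Option.some_inj] at h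
  rw [stepPos, if_pos (exists_pred_of_stepPos h'), Option.some_inj] at h'
  rw [← h, ← h', compress_le_iff]

theorem parent_le {q q' : M.Q} {c c' p p' : M.Slot} (h : stepPos pos a q = some c)
    (h' : stepPos pos a q' = some c') (hp : Parent pos a q p) (hp' : Parent pos a q' p')
    (hle : c ≤ c') : p ≤ p' := by
  classical
  have hv := (value_le_iff h h').2 hle
  rw [value_eq hp, value_eq hp'] at hv
  rw [Fin.le_def]
  split_ifs at hv <;> omega

theorem mem_of_parent_eq {q q' : M.Q} {c c' p : M.Slot} (h : stepPos pos a q = some c)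
    (h' : stepPos pos a q' = some c') (hp : Parent pos a q p) (hp' : Parent pos a q' p)
    (hlt : c < c') : q ∈ M.F ∧ q' ∉ M.F := by
  classical
  have hv := mt (value_le_iff h' h).1 (not_le.2 hlt)
  rw [value_eq hp, value_eq hp'] at hv
  split_ifs at hv <;> first | omega | exact ⟨by assumption, by assumption⟩

theorem mem_of_slot_eq {q q' : M.Q} {c : M.Slot} (h : stepPos pos a q = some c)
    (h' : stepPos pos a q' = some c) (hq : q ∈ M.F) : q' ∈ M.F := by
  classical
  obtain ⟨p, hp⟩ := exists_parent_of_stepPos h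
  obtain ⟨p', hp'⟩ := exists_parent_of_stepPos h'
  have hv := (value_le_iff h h').2 le_rfl
  have hv' := (value_le_iff h' h).2 le_rfl
  rw [value_eq hp, value_eq hp'] at hv hv'
  by_contra hn
  rw [if_pos hq, if_neg hn] at hv hv'
  omega

theorem key_le {rk : M.Slot → M.Slot} {p c : M.Slot} (h : NextSlot pos a p c) :
    key pos rk a c ≤ rk p :=
  Nat.sInf_le (Or.inr ⟨p, h, rfl⟩)

theorem key_mem (rk : M.Slot → M.Slot) (c : M.Slot) :
    key pos rk a c = Fintype.card M.Q + c ∨ ∃ p, NextSlot pos a p c ∧ key pos rk a c = rk p :=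
  Nat.sInf_mem (Set.insert_nonempty _ _)

theorem key_injective {rk : M.Slot → M.Slot} (hrk : Function.Injective rk) :
    Function.Injective (key pos rk a) := by
  intro c d h
  rcases key_mem (pos := pos) (a := a) rk c with hc | ⟨p, hp, hc⟩ <;>
    rcases key_mem (pos := pos) (a := a) rk d with hd | ⟨p', hp', hd⟩
  · ext; omega
  · have := (rk p').2; omega
  · have := (rk p).2; omega
  · obtain rfl : p = p' := hrk (by ext; omega)
    exact hp.unique hp'

theorem stepRk_injective {rk : M.Slot → M.Slot} (hrk : Function.Injective rk) :
    Function.Injective (stepRk pos rk a) := by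
  intro c d h
  exact compress_injective (key_injective hrk) (Fin.cast_injective _ h)

theorem stepRk_le {rk : M.Slot → M.Slot} (hrk : Function.Injective rk) {p c : M.Slot}
    (h : NextSlot pos a p c) : stepRk pos rk a c ≤ rk p :=
  (compress_le_value (key_injective hrk) c).trans (key_le h)

theorem stepRk_le_stepRk {rk : M.Slot → M.Slot} {p c d : M.Slot} (h : NextSlot pos a p c)
    (hd : ∀ q, NextSlot pos a q d → rk p ≤ rk q) : stepRk pos rk a c ≤ stepRk pos rk a d := by
  refine (compress_le_iff (key pos rk a) c d).2 ((key_le h).trans ?_)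
  rcases key_mem (pos := pos) (a := a) rk d with h' | ⟨q, hq, h'⟩
  · have := (rk p).2; omega
  · rw [h']; exact hd q hq

end Step

section Run

variable (M) (w : ℕ → A)

/-- The slice reached after reading `t` letters. -/
noncomputable def slice (t : ℕ) : M.Slice := (M.toDRA.run w t).1

/-- The ranking reached after reading `t` letters. -/
noncomputable def ranks (t : ℕ) : M.Slot → M.Slot := (M.toDRA.run w t).2.1

theorem slice_succ (t : ℕ) : M.slice w (t + 1) = stepPos (M.slice w t) (w t) := rfl

theorem ranks_succ (t : ℕ) :
    M.ranks w (t + 1) = stepRk (M.slice w t) (M.ranks w t) (w t) := rfl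

open Classical in
/-- The slot of level `t` containing the chosen predecessors of the slot `c` of level `t + 1`. -/
noncomputable def parentSlot (t : ℕ) (c : M.Slot) : M.Slot :=
  if h : ∃ p q, M.slice w (t + 1) q = some c ∧ Parent (M.slice w t) (w t) q p then h.choose else c

variable {M w}

theorem parentSlot_eq {t : ℕ} {q : M.Q} {c p : M.Slot} (hq : M.slice w (t + 1) q = some c)
    (hp : Parent (M.slice w t) (w t) q p) : M.parentSlot w t c = p := by
  have h : ∃ p q, M.slice w (t + 1) q = some c ∧ Parent (M.slice w t) (w t) q p := ⟨p, q, hq, hp⟩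
  rw [parentSlot, dif_pos h]
  obtain ⟨q', hq', hp'⟩ := h.choose_spec
  exact le_antisymm (parent_le hq' hq hp' hp le_rfl) (parent_le hq hq' hp hp' le_rfl)

theorem parent_parentSlot {t : ℕ} {q : M.Q} {c : M.Slot} (hq : M.slice w (t + 1) q = some c) :
    Parent (M.slice w t) (w t) q (M.parentSlot w t c) := by
  obtain ⟨p, hp⟩ := exists_parent_of_stepPos hq
  rwa [parentSlot_eq hq hp]

variable (M w) in
/-- The forest of slots along the word `w`. -/
noncomputable def forest : SliceForest M.Slot where
  P t := {c | ∃ q, M.slice w t q = some c}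
  π := M.parentSlot w
  F t := {c | ∃ q ∈ M.F, M.slice w t q = some c}
  parent_mem := by
    rintro t c ⟨q, hq⟩
    obtain ⟨q₀, h, -⟩ := (parent_parentSlot hq).1
    exact ⟨q₀, h⟩
  parent_mono := by
    rintro t c d ⟨q, hq⟩ ⟨q', hq'⟩ hle
    exact parent_le hq hq' (parent_parentSlot hq) (parent_parentSlot hq') hle
  siblings := by
    rintro t c d ⟨q, hq⟩ ⟨q', hq'⟩ hlt heq
    have hp' := parent_parentSlot hq'
    rw [← heq] at hp'
    obtain ⟨h1, h2⟩ := mem_of_parent_eq hq hq' (parent_parentSlot hq) hp' hlt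
    refine ⟨⟨q, h1, hq⟩, ?_⟩
    rintro ⟨q'', h3, h4⟩
    exact h2 (mem_of_slot_eq h4 hq' h3)

theorem next_iff {t : ℕ} {p c : M.Slot} :
    (M.forest w).Next t p c ↔ NextSlot (M.slice w t) (w t) p c := by
  have h : {c | c ∈ (M.forest w).P (t + 1) ∧ (M.forest w).π t c ≤ p} =
      {c | ∃ q p₀, stepPos (M.slice w t) (w t) q = some c ∧
        Parent (M.slice w t) (w t) q p₀ ∧ p₀ ≤ p} := by
    ext d
    constructor
    · rintro ⟨⟨q, hq⟩, hle⟩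
      exact ⟨q, _, hq, parent_parentSlot hq, hle⟩
    · rintro ⟨q, p₀, hq, hp, hle⟩
      exact ⟨⟨q, hq⟩, (parentSlot_eq hq hp).trans_le hle⟩
  rw [SliceForest.Next, NextSlot, h]

theorem continues_iff {t : ℕ} {p c : M.Slot} (hc : c ∈ (M.forest w).P (t + 1)) :
    Continues (M.slice w t) (w t) p c ↔
      ((M.forest w).π t c = p ∧ c ∉ (M.forest w).F (t + 1)) := by
  constructor
  · rintro ⟨q, hq, hp, hF⟩
    refine ⟨parentSlot_eq hq hp, ?_⟩
    rintro ⟨q', hF', hq'⟩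
    exact hF (mem_of_slot_eq hq' hq hF')
  · rintro ⟨rfl, hF⟩
    obtain ⟨q, hq⟩ := hc
    exact ⟨q, hq, parent_parentSlot hq, fun h => hF ⟨q, h, hq⟩⟩

variable (M w) in
theorem ranks_injective (t : ℕ) : Function.Injective (M.ranks w t) := by
  induction t with
  | zero => exact Function.injective_id
  | succ t ih => exact stepRk_injective ih

variable (M w) in
theorem ranking : (M.forest w).Ranking (M.ranks w) where
  inj := M.ranks_injective w
  le_of_next h := stepRk_le (M.ranks_injective w _) (next_iff.1 h)
  min_of_next h hd := stepRk_le_stepRk (next_iff.1 h) fun q hq => hd q (next_iff.2 hq)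

theorem toDRA_accepts_iff : M.toDRA.Accepts w ↔ ∃ r T, ∃ p : ℕ → M.Slot,
    (∀ t ≥ T, (M.forest w).Next t (p t) (p (t + 1)) ∧ M.ranks w t (p t) = r) ∧
    ∃ᶠ t in atTop, ¬ ((M.forest w).π t (p (t + 1)) = p t ∧
      p (t + 1) ∉ (M.forest w).F (t + 1)) := by
  classical
  have hacc : M.toDRA.Accepts w ↔ ∃ r : M.Slot,
      (∃ᶠ i in atTop, r ∈ (M.toDRA.run w i).2.2.2) ∧
      (∀ᶠ i in atTop, r ∈ (M.toDRA.run w i).2.2.1) := by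
    constructor
    · rintro ⟨pr, hpr, h1, h2⟩
      obtain ⟨r, -, rfl⟩ := Finset.mem_image.1 hpr
      exact ⟨r, h1, h2.mono fun i hi => not_not.1 hi⟩
    · rintro ⟨r, h1, h2⟩
      exact ⟨_, Finset.mem_image_of_mem _ (Finset.mem_univ r), h1,
        h2.mono fun i hi => not_not.2 hi⟩
  rw [hacc]
  constructor
  · rintro ⟨r, hfreq, hev⟩
    obtain ⟨T, hT⟩ := eventually_atTop.1 hev
    have hstable : ∀ t, ∃ p, t ≥ T → ∃ c, M.ranks w t p = r ∧
        NextSlot (M.slice w t) (w t) p c ∧ M.ranks w (t + 1) c = r := by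
      intro t
      by_cases ht : t ≥ T
      · obtain ⟨p, c, h⟩ := hT (t + 1) (by omega)
        exact ⟨p, fun _ => ⟨c, h⟩⟩
      · exact ⟨r, fun h => absurd h ht⟩
    choose p hp using hstable
    have hnext : ∀ t ≥ T, NextSlot (M.slice w t) (w t) (p t) (p (t + 1)) := by
      intro t ht
      obtain ⟨c, -, h1, h2⟩ := hp t ht
      obtain ⟨-, h3, -⟩ := hp (t + 1) (by omega)
      rwa [← M.ranks_injective w _ (h2.trans h3.symm)]
    have hrank : ∀ t ≥ T, M.ranks w t (p t) = r := fun t ht => (hp t ht).choose_spec.1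
    refine ⟨r, T, p, fun t ht => ⟨next_iff.2 (hnext t ht), hrank t ht⟩, ?_⟩
    rw [frequently_atTop] at hfreq ⊢
    intro n
    obtain ⟨i, hi, h⟩ := hfreq (max n T + 1)
    obtain ⟨t, rfl⟩ : ∃ t, i = t + 1 := ⟨i - 1, by omega⟩
    refine ⟨t, by omega, ?_⟩
    obtain ⟨p', c, h1, h2, h3⟩ := h
    obtain rfl : p' = p t := M.ranks_injective w t (h1.trans (hrank t (by omega)).symm)
    obtain rfl : c = p (t + 1) := h2.unique (hnext t (by omega))
    rwa [← continues_iff (next_iff.2 h2).1.1]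
  · rintro ⟨r, T, p, hp, hfreq⟩
    refine ⟨r, ?_, ?_⟩
    · rw [frequently_atTop] at hfreq ⊢
      intro n
      obtain ⟨t, ht, h⟩ := hfreq (max n T)
      obtain ⟨h1, h2⟩ := hp t (by omega)
      rw [← continues_iff h1.1.1] at h
      exact ⟨t + 1, by omega, p t, p (t + 1), h2, next_iff.1 h1, h⟩
    · refine eventually_atTop.2 ⟨T + 1, fun i hi => ?_⟩
      obtain ⟨t, rfl⟩ : ∃ t, i = t + 1 := ⟨i - 1, by omega⟩
      obtain ⟨h1, h2⟩ := hp t (by omega)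
      exact ⟨p t, p (t + 1), h2, next_iff.1 h1, (hp (t + 1) (by omega)).2⟩

theorem exists_branch_of_accepts (h : M.Accepts w) :
    ∃ B, (M.forest w).IsBranch 0 B ∧ ∃ᶠ t in atTop, B (t + 1) ∈ (M.forest w).F (t + 1) := by
  obtain ⟨ρ, h0, hstep, hF⟩ := h
  have hlive : ∀ t, ∃ c, M.slice w t (ρ t) = some c := by
    intro t
    induction t with
    | zero => exact ⟨_, if_pos h0⟩
    | succ t ih =>
      obtain ⟨c, hc⟩ := ih
      exact exists_stepPos hc (hstep t)
  choose x hx using hlive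
  refine (M.forest w).exists_branch_of_drift (x := x) (fun t _ => ⟨ρ t, hx t⟩)
    (fun t _ => (parent_parentSlot (hx (t + 1))).2 ⟨ρ t, hx t, hstep t⟩) ?_
  rw [frequently_atTop] at hF ⊢
  intro n
  obtain ⟨i, hi, h⟩ := hF (n + 1)
  obtain ⟨t, rfl⟩ : ∃ t, i = t + 1 := ⟨i - 1, by omega⟩
  exact ⟨t, by omega, fun hn => hn.2 ⟨ρ (t + 1), h, hx (t + 1)⟩⟩

theorem accepts_of_branch {T : ℕ} {B : ℕ → M.Slot} (hB : (M.forest w).IsBranch T B)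
    (hF : ∃ᶠ t in atTop, B (t + 1) ∈ (M.forest w).F (t + 1)) : M.Accepts w := by
  let X : ℕ → Set M.Q := fun t => {q | ∃ c, M.slice w t q = some c ∧ (t ≥ T → c = B t)}
  have hpred : ∀ t q, q ∈ X (t + 1) → ∃ q₀ ∈ X t, q ∈ M.δ q₀ (w t) := by
    rintro t q ⟨c, hc, hcB⟩
    obtain ⟨q₀, h1, h2⟩ := (parent_parentSlot hc).1
    refine ⟨q₀, ⟨_, h1, fun ht => ?_⟩, h2⟩
    rw [hcB (by omega)]
    exact (hB t ht).2
  have hpath : ∀ n, ∀ q ∈ X n, ∃ a : ℕ → M.Q, a n = q ∧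
      ∀ k < n, a k ∈ X k ∧ a (k + 1) ∈ X (k + 1) ∧ a (k + 1) ∈ M.δ (a k) (w k) := by
    intro n
    induction n with
    | zero => exact fun q _ => ⟨fun _ => q, rfl, fun k hk => absurd hk (Nat.not_lt_zero k)⟩
    | succ n ih =>
      intro q hq
      obtain ⟨q₀, h1, h2⟩ := hpred n q hq
      obtain ⟨a, ha, hstep⟩ := ih q₀ h1
      refine ⟨fun k => if k ≤ n then a k else q, by simp, fun k hk => ?_⟩
      rcases Nat.lt_succ_iff_lt_or_eq.1 hk with hk | rfl
      · simpa [hk, hk.le] using hstep k hk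
      · simpa [ha] using ⟨h1, hq, h2⟩
  obtain ⟨ρ, hρ⟩ := exists_path_of_finite_paths
    (fun k x y => x ∈ X k ∧ y ∈ X (k + 1) ∧ y ∈ M.δ x (w k)) fun n => by
      obtain ⟨q, hq⟩ := (hB (max n T) (le_max_right _ _)).1
      obtain ⟨a, -, ha⟩ := hpath (max n T) q ⟨_, hq, fun _ => rfl⟩
      exact ⟨a, fun k hk => ha k (lt_of_lt_of_le hk (le_max_left _ _))⟩
  refine ⟨ρ, ?_, fun i => (hρ i).2.2, ?_⟩
  · obtain ⟨c, hc, -⟩ := (hρ 0).1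
    by_contra hne
    exact absurd ((if_neg hne).symm.trans hc) (by simp)
  · rw [frequently_atTop] at hF ⊢
    intro n
    obtain ⟨t, ht, q, hq, hqB⟩ := hF (max n T)
    obtain ⟨c, hc, hcB⟩ := (hρ t).2.1
    refine ⟨t + 1, by omega, mem_of_slot_eq hqB ?_ hq⟩
    rw [← hcB (by omega)]
    exact hc

/-- The determinization recognizes the language of the Büchi automaton. -/
theorem accepts_iff_toDRA_accepts : M.Accepts w ↔ M.toDRA.Accepts w := by
  rw [toDRA_accepts_iff]
  constructor
  · intro h
    obtain ⟨B, hB, hF⟩ := exists_branch_of_accepts h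
    exact (M.ranking w).exists_rank_of_branch hB hF
  · rintro ⟨r, T, p, hp, hfreq⟩
    obtain ⟨B, hB, hF⟩ := (M.forest w).exists_branch_of_drift (T := T + 1) (x := p)
      (fun t ht => by
        obtain ⟨s, rfl⟩ : ∃ s, t = s + 1 := ⟨t - 1, by omega⟩
        exact (hp s (by omega)).1.1.1)
      (fun t ht => (hp t (by omega)).1.1.2) hfreq
    exact accepts_of_branch hB hF

end Run

variable (M)

theorem card_toDRA_Q : Fintype.card M.toDRA.Q =
    (Fintype.card M.Q + 1) ^ Fintype.card M.Q * (Fintype.card M.Q ^ Fintype.card M.Q *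
      (2 ^ Fintype.card M.Q * 2 ^ Fintype.card M.Q)) := by
  classical
  have h : Fintype.card M.toDRA.Q = Fintype.card M.State := Fintype.card_congr (Equiv.refl _)
  rw [h]
  simp

theorem card_toDRA_R : M.toDRA.R.card ≤ Fintype.card M.Q := by
  classical
  refine Finset.card_image_le.trans ?_
  simp

end NBA

namespace NPA

variable {A : Type} (P : NPA A)

/-- The priorities occurring in a parity automaton. -/
abbrev Priority : Type := {k : ℕ // k ∈ Finset.univ.image P.Ω}

/-- The Büchi automaton that guesses a priority `k` and a position from which on no priority below
`k` occurs, and checks that `k` is even and occurs infinitely often. -/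
def toNBA : NBA A where
  Q := P.Q × Option P.Priority
  δ x a := {y | y.1 ∈ P.Δ x.1 a ∧ (∀ k, x.2 = some k → y.2 = some k) ∧
    ∀ k, y.2 = some k → (k : ℕ) ≤ P.Ω y.1}
  qI := (P.qI, none)
  F := {x | ∃ k, x.2 = some k ∧ P.Ω x.1 = k ∧ Even (k : ℕ)}

theorem accepts_iff_toNBA_accepts (w : ℕ → A) : P.Accepts w ↔ P.toNBA.Accepts w := by
  constructor
  · rintro ⟨ρ, ⟨h0, hstep⟩, k, ⟨hk, hleast⟩, heven⟩
    have hkmem : k ∈ Finset.univ.image P.Ω := by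
      obtain ⟨i, hi⟩ := hk.exists
      exact Finset.mem_image.2 ⟨_, Finset.mem_univ _, hi⟩
    have hge : ∀ᶠ i in atTop, k ≤ P.Ω (ρ i) := by
      have h : ∀ᶠ i in atTop, ∀ j ∈ Finset.range k, P.Ω (ρ i) ≠ j := by
        rw [Filter.eventually_all_finset]
        intro j hj
        by_contra hn
        have hj' : ∃ᶠ i in atTop, P.Ω (ρ i) = j := by
          simpa [Filter.Frequently] using hn
        exact absurd (hleast hj') (by simpa using hj)
      refine h.mono fun i hi => ?_
      by_contra hlt
      exact hi _ (Finset.mem_range.2 (not_le.1 hlt)) rfl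
    obtain ⟨T, hT⟩ := eventually_atTop.1 hge
    refine ⟨fun i => (ρ i, if i ≤ T then none else some ⟨k, hkmem⟩), ?_, ?_, ?_⟩
    · simp [h0, toNBA]
    · refine fun i => ⟨hstep i, fun j hj => ?_, fun j hj => ?_⟩
      · by_cases hi : i ≤ T
        · simp [hi] at hj
        · simp only [hi, if_false] at hj
          simp [show ¬ i + 1 ≤ T by omega, hj]
      · by_cases hi : i + 1 ≤ T
        · simp [hi] at hj
        · simp only [hi, if_false, Option.some_inj] at hj
          rw [← hj]
          exact hT (i + 1) (by omega)
    · refine (hk.and_eventually (eventually_gt_atTop T)).mono fun i hi => ?_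
      exact ⟨⟨k, hkmem⟩, if_neg (not_le.2 hi.2), hi.1, heven⟩
  · rintro ⟨ρ, h0, hstep, hF⟩
    obtain ⟨T, k, hTk, -, heven⟩ := hF.exists
    have hk : ∀ t ≥ T, (ρ t).2 = some k := by
      intro t ht
      induction t, ht using Nat.le_induction with
      | base => exact hTk
      | succ t ht ih => exact (hstep t).2.1 k ih
    refine ⟨fun i => (ρ i).1, ⟨congrArg Prod.fst h0, fun i => (hstep i).1⟩, k, ⟨?_, ?_⟩, heven⟩
    · refine (hF.and_eventually (eventually_ge_atTop T)).mono ?_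
      rintro i ⟨⟨j, hj, hΩ, -⟩, hi⟩
      obtain rfl : k = j := Option.some_inj.1 ((hk i hi).symm.trans hj)
      exact hΩ
    · intro j hj
      obtain ⟨i, hi, hge⟩ := (hj.and_eventually (eventually_gt_atTop T)).exists
      obtain ⟨t, rfl⟩ : ∃ t, i = t + 1 := ⟨i - 1, by omega⟩
      rw [← hi]
      exact (hstep t).2.2 k (hk (t + 1) (by omega))

theorem card_toNBA_Q : Fintype.card P.toNBA.Q =
    Fintype.card P.Q * ((Finset.univ.image P.Ω).card + 1) := by
  have h : Fintype.card P.toNBA.Q = Fintype.card (P.Q × Option P.Priority) :=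
    Fintype.card_congr (Equiv.refl _)
  rw [h, Fintype.card_prod, Fintype.card_option, Fintype.card_coe]

theorem card_image_priority_le {m : ℕ} (hm : ∀ q, P.Ω q ≤ m) :
    (Finset.univ.image P.Ω).card ≤ m + 1 := by
  rw [← Finset.card_range (m + 1)]
  refine Finset.card_le_card (Finset.image_subset_iff.2 fun q _ => ?_)
  exact Finset.mem_range.2 (Nat.lt_succ_of_le (hm q))

end NPA

/-- Determinization of parity automata into Rabin automata with at most
`n^(C·(m+1)·n)` states and `C·(m+1)·2^n` Rabin pairs, for some absolute constant `C`. -/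
theorem npa_to_dra_size :
    ∃ C : ℕ, ∀ (A : Type) [Fintype A] [Nonempty A] (P : NPA A) (m : ℕ),
      2 ≤ Fintype.card P.Q → (∀ q : P.Q, P.Ω q ≤ m) →
      ∃ D : DRA A,
        (∀ w : ℕ → A, P.Accepts w ↔ D.Accepts w) ∧
        Fintype.card D.Q ≤ Fintype.card P.Q ^ (C * (m + 1) * Fintype.card P.Q) ∧
        D.R.card ≤ C * (m + 1) * 2 ^ Fintype.card P.Q := by
  refine ⟨20, fun A _ _ P m hn hm => ⟨P.toNBA.toDRA, fun w => ?_, ?_, ?_⟩⟩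
  · exact (P.accepts_iff_toNBA_accepts w).trans NBA.accepts_iff_toDRA_accepts
  · rw [NBA.card_toDRA_Q]
    have hN := P.card_toNBA_Q
    have hc₁ : (Finset.univ.image P.Ω).card ≤ Fintype.card P.Q := Finset.card_image_le
    have hc₂ := P.card_image_priority_le hm
    generalize Fintype.card P.toNBA.Q = N at hN ⊢
    generalize (Finset.univ.image P.Ω).card = c at hN hc₁ hc₂
    generalize Fintype.card P.Q = n at *
    have h1 : N + 1 ≤ n ^ 4 := by
      have h2 : N ≤ n * (n + 1) := hN.trans_le (Nat.mul_le_mul_left n (by omega))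
      nlinarith [Nat.mul_le_mul hn hn, Nat.mul_le_mul (Nat.mul_le_mul hn hn) (le_refl (n ^ 2))]
    have hN2 : N ≤ 2 * ((m + 1) * n) := by
      rw [hN]
      nlinarith [Nat.mul_le_mul_left n hc₂, Nat.zero_le (n * m)]
    calc (N + 1) ^ N * (N ^ N * (2 ^ N * 2 ^ N))
        ≤ (n ^ 4) ^ N * ((n ^ 4) ^ N * (n ^ N * n ^ N)) := by
          gcongr
          omega
      _ = n ^ (10 * N) := by ring
      _ ≤ n ^ (20 * (m + 1) * n) := Nat.pow_le_pow_right (by omega) (by linarith)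
  · refine P.toNBA.card_toDRA_R.trans ?_
    rw [P.card_toNBA_Q]
    have hc₂ := P.card_image_priority_le hm
    have h1 : Fintype.card P.Q ≤ 2 ^ Fintype.card P.Q := Nat.lt_two_pow_self.le
    calc Fintype.card P.Q * ((Finset.univ.image P.Ω).card + 1)
        ≤ 2 ^ Fintype.card P.Q * (20 * (m + 1)) := Nat.mul_le_mul h1 (by omega)
      _ = 20 * (m + 1) * 2 ^ Fintype.card P.Q := by ring
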